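/- Let α and β be π-terms over a finite alphabet Σ. Then [α]_{ω+ω*} ≡_m^{XY} [β]_{ω+ω*} holds for all m ∈ ℕ if and only if the equation α = β holds in every finite monoid in DA. -/

import Mathlib

open scoped Classical

/-! ## Generalized words -/

structure GWord (A : Type) : Type 1 where
  P : Type
  ord : LinearOrder P
  w : P → A

namespace GWord

variable {A : Type}

instance (u : GWord A) : LinearOrder u.P := u.ord

/-- The set of letters occurring in a generalized word. -/
def alph (u : GWord A) : Set A := Set.range u.w

/-- Restriction of a generalized word to a set of positions. -/
def restrict (u : GWord A) (s : Set u.P) : GWord A :=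
  ⟨{ p // p ∈ s }, inferInstance, fun p => u.w p.1⟩

/-- `p` is the first `a`-labelled position of `u`. -/
def IsFirst (u : GWord A) (a : A) (p : u.P) : Prop :=
  u.w p = a ∧ ∀ q : u.P, u.w q = a → p ≤ q

/-- `p` is the last `a`-labelled position of `u`. -/
def IsLast (u : GWord A) (a : A) (p : u.P) : Prop :=
  u.w p = a ∧ ∀ q : u.P, u.w q = a → q ≤ p

/-- The factor strictly before the first occurrence of `a`. -/
noncomputable def XL (u : GWord A) (a : A) : GWord A :=
  if h : ∃ p, u.IsFirst a p then u.restrict {q | q < h.choose} else u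

/-- The factor strictly after the first occurrence of `a`. -/
noncomputable def XR (u : GWord A) (a : A) : GWord A :=
  if h : ∃ p, u.IsFirst a p then u.restrict {q | h.choose < q} else u

/-- The factor strictly before the last occurrence of `a`. -/
noncomputable def YL (u : GWord A) (a : A) : GWord A :=
  if h : ∃ p, u.IsLast a p then u.restrict {q | q < h.choose} else u

/-- The factor strictly after the last occurrence of `a`. -/
noncomputable def YR (u : GWord A) (a : A) : GWord A :=
  if h : ∃ p, u.IsLast a p then u.restrict {q | h.choose < q} else u

/-- `C_{a,b}` is defined iff the first `a` is strictly to the right of the last `b`. -/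
def CDefined (u : GWord A) (a b : A) : Prop :=
  ∃ p q, u.IsFirst a p ∧ u.IsLast b q ∧ q < p

/-- The factor strictly between the last `b` and the first `a` (junk value if undefined). -/
noncomputable def Cab (u : GWord A) (a b : A) : GWord A :=
  if h : u.CDefined a b then
    u.restrict {r | h.choose_spec.choose < r ∧ r < h.choose}
  else u

/-- Accessibility: first/last occurrences of letters after/before every position exist. -/
def Accessible (u : GWord A) : Prop :=
  (∀ a : A, (∃ p, u.w p = a) → ∃ p, u.IsFirst a p) ∧
  (∀ a : A, (∃ p, u.w p = a) → ∃ p, u.IsLast a p) ∧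
  (∀ (p : u.P) (a : A), (∃ q, p < q ∧ u.w q = a) →
    ∃ q, p < q ∧ u.w q = a ∧ ∀ r, p < r → u.w r = a → q ≤ r) ∧
  (∀ (p : u.P) (a : A), (∃ q, q < p ∧ u.w q = a) →
    ∃ q, q < p ∧ u.w q = a ∧ ∀ r, r < p → u.w r = a → r ≤ q)

/-- Concatenation of generalized words. -/
def append (u v : GWord A) : GWord A :=
  ⟨u.P ⊕ₗ v.P, inferInstance, fun x => Sum.elim u.w v.w (ofLex x)⟩

/-- The power of a generalized word by an arbitrary linear order type `ν`
(positions ordered with the exponent component dominant). -/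
def gpow (u : GWord A) (ν : Type) [LinearOrder ν] : GWord A :=
  ⟨ν ×ₗ u.P, inferInstance, fun x => u.w (ofLex x).2⟩

/-- A finite word as a generalized word. -/
def ofList (l : List A) : GWord A :=
  ⟨Fin l.length, inferInstance, fun i => l.get i⟩

end GWord

/-- The order type `ω + ω*`: a copy of `ℕ` followed by a reversed copy of `ℕ`. -/
abbrev OO : Type := ℕ ⊕ₗ ℕᵒᵈ

/-! ## The relations `≡_{m,n}^Z` -/

inductive ZK : Type
  | X | Y | WI

inductive ZKind : Type
  | X | Y | XY | WI

/-- The relations `≡_{m,n}^X`, `≡_{m,n}^Y`, `≡_{m,n}^{WI}` (first argument is `n`). -/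
def eqvAux {A : Type} : ℕ → ZK → ℕ → GWord A → GWord A → Prop
  | 0, _, _, _, _ => True
  | _ + 1, _, 0, _, _ => True
  | n + 1, ZK.X, m + 1, u, v =>
      u.alph = v.alph ∧ eqvAux n ZK.Y m u v ∧
      ∀ a ∈ u.alph, eqvAux n ZK.Y m (u.XL a) (v.XL a) ∧
        eqvAux n ZK.X (m + 1) (u.XR a) (v.XR a)
  | n + 1, ZK.Y, m + 1, u, v =>
      u.alph = v.alph ∧ eqvAux n ZK.X m u v ∧
      ∀ a ∈ u.alph, eqvAux n ZK.Y (m + 1) (u.YL a) (v.YL a) ∧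
        eqvAux n ZK.X m (u.YR a) (v.YR a)
  | n + 1, ZK.WI, m + 1, u, v =>
      u.alph = v.alph ∧
      (∀ a ∈ u.alph,
        eqvAux n ZK.WI m (u.XL a) (v.XL a) ∧ eqvAux n ZK.WI (m + 1) (u.XR a) (v.XR a) ∧
        eqvAux n ZK.WI (m + 1) (u.YL a) (v.YL a) ∧ eqvAux n ZK.WI m (u.YR a) (v.YR a)) ∧
      ∀ a ∈ u.alph, ∀ b ∈ u.alph,
        (u.CDefined a b ↔ v.CDefined a b) ∧
        (u.CDefined a b → v.CDefined a b → eqvAux n ZK.WI m (u.Cab a b) (v.Cab a b))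

/-- `wEquiv Z m n u v` is `u ≡_{m,n}^Z v`. -/
def wEquiv {A : Type} (Z : ZKind) (m n : ℕ) (u v : GWord A) : Prop :=
  match Z with
  | ZKind.X => eqvAux n ZK.X m u v
  | ZKind.Y => eqvAux n ZK.Y m u v
  | ZKind.XY => eqvAux n ZK.X m u v ∧ eqvAux n ZK.Y m u v
  | ZKind.WI => eqvAux n ZK.WI m u v

/-! ## π-terms -/

inductive PiTerm (A : Type) : Type
  | eps : PiTerm A
  | letter : A → PiTerm A
  | mul : PiTerm A → PiTerm A → PiTerm A
  | pi : PiTerm A → PiTerm A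

def listNPow {A : Type} (l : List A) : ℕ → List A
  | 0 => []
  | k + 1 => l ++ listNPow l k

/-- `[γ]_k`: substitute the natural number `k` for the formal power `π`. -/
def PiTerm.substNat {A : Type} : PiTerm A → ℕ → List A
  | .eps, _ => []
  | .letter a, _ => [a]
  | .mul α β, k => α.substNat k ++ β.substNat k
  | .pi γ, k => listNPow (γ.substNat k) k

/-- `[γ]_{ω+ω*}`: substitute the order type `ω + ω*` for the formal power `π`. -/
def PiTerm.substOO {A : Type} : PiTerm A → GWord A
  | .eps => GWord.ofList []
  | .letter a => GWord.ofList [a]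
  | .mul α β => α.substOO.append β.substOO
  | .pi γ => γ.substOO.gpow OO

/-! ## Finite monoids, equations, the Trotter–Weil hierarchy -/

/-- `M!`: the exponent of a finite monoid, the least `n ≥ 1` such that all `x^n` are
idempotent. -/
noncomputable def monoidExp (M : Type) [Monoid M] : ℕ :=
  sInf {n : ℕ | 1 ≤ n ∧ ∀ x : M, IsIdempotentElem (x ^ n)}

/-- The equation `α = β` of π-terms holds in the finite monoid `M`. -/
def EqHoldsIn {A : Type} (α β : PiTerm A) (M : Type) [Monoid M] : Prop :=
  ∀ σ : FreeMonoid A →* M,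
    σ (FreeMonoid.ofList (α.substNat (monoidExp M))) =
      σ (FreeMonoid.ofList (β.substNat (monoidExp M)))

/-- Green's relation `R`: `x R y` iff `xM = yM`. -/
def rGreen {M : Type} [Monoid M] (x y : M) : Prop :=
  Set.range (fun z => x * z) = Set.range (fun z => y * z)

/-- Green's relation `L`: `x L y` iff `Mx = My`. -/
def lGreen {M : Type} [Monoid M] (x y : M) : Prop :=
  Set.range (fun z => z * x) = Set.range (fun z => z * y)

/-- `J`-triviality: `MxM = MyM` implies `x = y`. -/
def IsJTrivial (M : Type) [Monoid M] : Prop :=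
  ∀ x y : M, {z | ∃ a b, z = a * x * b} = {z | ∃ a b, z = a * y * b} → x = y

/-- The relation `∼_K`. -/
def simK {M : Type} [Monoid M] (x y : M) : Prop :=
  ∀ e : M, IsIdempotentElem e → (rGreen (e * x) e ∨ rGreen (e * y) e) → e * x = e * y

/-- The relation `∼_D`. -/
def simD {M : Type} [Monoid M] (x y : M) : Prop :=
  ∀ e : M, IsIdempotentElem e → (lGreen (x * e) e ∨ lGreen (y * e) e) → x * e = y * e

/-- `∼_K` as a congruence (it is a congruence, so `conGen` does not change it). -/
def KCon (M : Type) [Monoid M] : Con M := conGen simK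

/-- `∼_D` as a congruence. -/
def DCon (M : Type) [Monoid M] : Con M := conGen simD

/-- `InRLAux k true M _ = (M ∈ R_{k+1})` and `InRLAux k false M _ = (M ∈ L_{k+1})`. -/
def InRLAux : ℕ → Bool → (M : Type) → Monoid M → Prop
  | 0, _, M, i => letI := i; IsJTrivial M
  | k + 1, true, M, i => letI := i; InRLAux k false (KCon M).Quotient inferInstance
  | k + 1, false, M, i => letI := i; InRLAux k true (DCon M).Quotient inferInstance

/-- `M ∈ R_m` (for `m ≥ 1`). -/
def InRm (m : ℕ) (M : Type) [i : Monoid M] : Prop := InRLAux (m - 1) true M i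

/-- `M ∈ L_m` (for `m ≥ 1`). -/
def InLm (m : ℕ) (M : Type) [i : Monoid M] : Prop := InRLAux (m - 1) false M i

/-- `N` divides `M`: `N` is a homomorphic image of a submonoid of `M`. -/
def MDivides (N M : Type) [Monoid N] [Monoid M] : Prop :=
  ∃ (S : Submonoid M) (f : S →* N), Function.Surjective f

/-- `N ∈ R_m ∨ L_m`: `N` divides a direct product `M₁ × M₂` with `M₁ ∈ R_m`, `M₂ ∈ L_m`. -/
def InJoin (m : ℕ) (N : Type) [Monoid N] : Prop :=
  ∃ (M₁ M₂ : Type) (i₁ : Monoid M₁) (i₂ : Monoid M₂),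
    letI := i₁; letI := i₂;
    Finite M₁ ∧ Finite M₂ ∧ InRm m M₁ ∧ InLm m M₂ ∧ MDivides N (M₁ × M₂)

/-- `M ∈ DA`, via the equation `(xyz)^{M!} y (xyz)^{M!} = (xyz)^{M!}`. -/
def InDA (M : Type) [Monoid M] : Prop :=
  ∀ x y z : M,
    (x * y * z) ^ monoidExp M * y * (x * y * z) ^ monoidExp M = (x * y * z) ^ monoidExp M

/-! ## The π-terms `U_m`, `V_m` -/

inductive UVLetter : Type
  | s | t | x (i : ℕ) | y (i : ℕ)

/-- `U_m` (indexed from 1; `Uterm 0` is a junk value). -/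
def Uterm : ℕ → PiTerm UVLetter
  | 0 => PiTerm.eps
  | 1 =>
      PiTerm.mul
        (PiTerm.pi (PiTerm.mul (PiTerm.letter UVLetter.s) (PiTerm.letter (UVLetter.x 1))))
        (PiTerm.mul (PiTerm.letter UVLetter.s)
          (PiTerm.pi (PiTerm.mul (PiTerm.letter (UVLetter.y 1)) (PiTerm.letter UVLetter.t))))
  | m + 2 =>
      PiTerm.mul
        (PiTerm.pi (PiTerm.mul (Uterm (m + 1)) (PiTerm.letter (UVLetter.x (m + 2)))))
        (PiTerm.mul (Uterm (m + 1))
          (PiTerm.pi (PiTerm.mul (PiTerm.letter (UVLetter.y (m + 2))) (Uterm (m + 1)))))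

/-- `V_m` (indexed from 1; `Vterm 0` is a junk value). -/
def Vterm : ℕ → PiTerm UVLetter
  | 0 => PiTerm.eps
  | 1 =>
      PiTerm.mul
        (PiTerm.pi (PiTerm.mul (PiTerm.letter UVLetter.s) (PiTerm.letter (UVLetter.x 1))))
        (PiTerm.mul (PiTerm.letter UVLetter.t)
          (PiTerm.pi (PiTerm.mul (PiTerm.letter (UVLetter.y 1)) (PiTerm.letter UVLetter.t))))
  | m + 2 =>
      PiTerm.mul
        (PiTerm.pi (PiTerm.mul (Uterm (m + 1)) (PiTerm.letter (UVLetter.x (m + 2)))))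
        (PiTerm.mul (Vterm (m + 1))
          (PiTerm.pi (PiTerm.mul (PiTerm.letter (UVLetter.y (m + 2))) (Uterm (m + 1)))))

/-- The relation `≡_{m,n}^Z` on the free monoid `Σ*`, as a congruence
(it is a congruence, so `conGen` does not change it). -/
def eqvCon (A : Type) (Z : ZKind) (m n : ℕ) : Con (FreeMonoid A) :=
  conGen (fun u v => wEquiv Z m n (GWord.ofList u.toList) (GWord.ofList v.toList))

/-! ## Factorizations of π-terms -/

namespace PiTerm

variable {A : Type}

/-- The set of letters occurring in a π-term. -/
def alph : PiTerm A → Set A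
  | eps => ∅
  | letter a => {a}
  | mul α β => α.alph ∪ β.alph
  | pi γ => γ.alph

/-- A π-term for the factor before the first occurrence of `a`. -/
noncomputable def XL (a : A) : PiTerm A → PiTerm A
  | eps => eps
  | letter _ => eps
  | mul α β => if a ∈ α.alph then α.XL a else mul α (β.XL a)
  | pi γ => γ.XL a

/-- A π-term for the factor after the first occurrence of `a`. -/
noncomputable def XR (a : A) : PiTerm A → PiTerm A
  | eps => eps
  | letter _ => eps
  | mul α β => if a ∈ α.alph then mul (α.XR a) β else β.XR a
  | pi γ => mul (γ.XR a) (pi γ)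

/-- A π-term for the factor before the last occurrence of `a`. -/
noncomputable def YL (a : A) : PiTerm A → PiTerm A
  | eps => eps
  | letter _ => eps
  | mul α β => if a ∈ β.alph then mul α (β.YL a) else α.YL a
  | pi γ => mul (pi γ) (γ.YL a)

/-- A π-term for the factor after the last occurrence of `a`. -/
noncomputable def YR (a : A) : PiTerm A → PiTerm A
  | eps => eps
  | letter _ => eps
  | mul α β => if a ∈ β.alph then β.YR a else mul (α.YR a) β
  | pi γ => γ.YR a

/-- Equivalence of π-terms under all nested factorizations of depth less than `n`. -/
def FactorEquiv : ℕ → PiTerm A → PiTerm A → Prop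
  | 0, _, _ => True
  | n + 1, α, β => α.alph = β.alph ∧ ∀ a ∈ α.alph,
      FactorEquiv n (α.XL a) (β.XL a) ∧ FactorEquiv n (α.XR a) (β.XR a) ∧
      FactorEquiv n (α.YL a) (β.YL a) ∧ FactorEquiv n (α.YR a) (β.YR a)

namespace FactorEquiv

theorem refl (n : ℕ) (α : PiTerm A) : FactorEquiv n α α := by
  induction n generalizing α with
  | zero => trivial
  | succ n ih => exact ⟨rfl, fun a _ => ⟨ih _, ih _, ih _, ih _⟩⟩

theorem symm {n : ℕ} {α β : PiTerm A} (h : FactorEquiv n α β) : FactorEquiv n β α := by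
  induction n generalizing α β with
  | zero => trivial
  | succ n ih =>
    refine ⟨h.1.symm, fun a ha => ?_⟩
    obtain ⟨h1, h2, h3, h4⟩ := h.2 a (h.1 ▸ ha)
    exact ⟨ih h1, ih h2, ih h3, ih h4⟩

theorem trans {n : ℕ} {α β γ : PiTerm A} (h : FactorEquiv n α β) (h' : FactorEquiv n β γ) :
    FactorEquiv n α γ := by
  induction n generalizing α β γ with
  | zero => trivial
  | succ n ih =>
    refine ⟨h.1.trans h'.1, fun a ha => ?_⟩
    obtain ⟨h1, h2, h3, h4⟩ := h.2 a ha
    obtain ⟨k1, k2, k3, k4⟩ := h'.2 a (h.1 ▸ ha)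
    exact ⟨ih h1 k1, ih h2 k2, ih h3 k3, ih h4 k4⟩

theorem pred {n : ℕ} {α β : PiTerm A} (h : FactorEquiv (n + 1) α β) : FactorEquiv n α β := by
  induction n generalizing α β with
  | zero => trivial
  | succ n ih =>
    refine ⟨h.1, fun a ha => ?_⟩
    obtain ⟨h1, h2, h3, h4⟩ := h.2 a ha
    exact ⟨ih h1, ih h2, ih h3, ih h4⟩

theorem mul {n : ℕ} {α α' β β' : PiTerm A} (h : FactorEquiv n α α') (h' : FactorEquiv n β β') :
    FactorEquiv n (α.mul β) (α'.mul β') := by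
  induction n generalizing α α' β β' with
  | zero => trivial
  | succ n ih =>
    refine ⟨by simp only [alph, h.1, h'.1], fun a ha => ?_⟩
    have e : (a ∈ α'.alph) = (a ∈ α.alph) := by rw [h.1]
    have e' : (a ∈ β'.alph) = (a ∈ β.alph) := by rw [h'.1]
    simp only [XL, XR, YL, YR, e, e']
    refine ⟨?_, ?_, ?_, ?_⟩
    · split_ifs with c
      · exact (h.2 a c).1
      · exact ih h.pred (h'.2 a (ha.resolve_left c)).1
    · split_ifs with c
      · exact ih (h.2 a c).2.1 h'.pred
      · exact (h'.2 a (ha.resolve_left c)).2.1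
    · split_ifs with c
      · exact ih h.pred (h'.2 a c).2.2.1
      · exact (h.2 a (ha.resolve_right c)).2.2.1
    · split_ifs with c
      · exact (h'.2 a c).2.2.2
      · exact ih (h.2 a (ha.resolve_right c)).2.2.2 h'.pred

theorem assoc (n : ℕ) (α β γ : PiTerm A) :
    FactorEquiv n ((α.mul β).mul γ) (α.mul (β.mul γ)) := by
  induction n generalizing α β γ with
  | zero => trivial
  | succ n ih =>
    refine ⟨Set.union_assoc _ _ _, fun a _ => ?_⟩
    by_cases c : a ∈ α.alph <;> by_cases d : a ∈ β.alph <;> by_cases e : a ∈ γ.alph <;>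
      simp [XL, XR, YL, YR, alph, c, d, e, ih, refl]

theorem eps_mul (n : ℕ) (α : PiTerm A) : FactorEquiv n (eps.mul α) α := by
  induction n generalizing α with
  | zero => trivial
  | succ n ih =>
    refine ⟨Set.empty_union _, fun a ha => ?_⟩
    have c : a ∈ α.alph := by simpa [alph] using ha
    simp [XL, XR, YL, YR, alph, c, ih, refl]

theorem mul_eps (n : ℕ) (α : PiTerm A) : FactorEquiv n (α.mul eps) α := by
  induction n generalizing α with
  | zero => trivial
  | succ n ih =>
    refine ⟨Set.union_empty _, fun a ha => ?_⟩
    have c : a ∈ α.alph := by simpa [alph] using ha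
    simp [XL, XR, YL, YR, alph, c, ih, refl]

end FactorEquiv

/-- The `k`-fold product of a π-term. -/
def npow (α : PiTerm A) : ℕ → PiTerm A
  | 0 => eps
  | k + 1 => α.mul (npow α k)

theorem alph_npow_subset (α : PiTerm A) (k : ℕ) : (α.npow k).alph ⊆ α.alph := by
  induction k with
  | zero => exact Set.empty_subset _
  | succ k ih => exact Set.union_subset subset_rfl ih

theorem alph_npow_succ (α : PiTerm A) (k : ℕ) : (α.npow (k + 1)).alph = α.alph :=
  Set.union_eq_left.2 (alph_npow_subset α k)

namespace FactorEquiv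

theorem npow_succ (n : ℕ) (α : PiTerm A) (k : ℕ) :
    FactorEquiv n (α.npow (k + 1)) ((α.npow k).mul α) := by
  induction k with
  | zero => exact (mul_eps n α).trans (eps_mul n α).symm
  | succ k ih => exact ((refl n α).mul ih).trans (assoc n _ _ _).symm

theorem npow_congr {n : ℕ} {α β : PiTerm A} (h : FactorEquiv n α β) (k : ℕ) :
    FactorEquiv n (α.npow k) (β.npow k) := by
  induction k with
  | zero => exact refl n _
  | succ k ih => exact h.mul ih

theorem pi_npow {n k : ℕ} (h : n ≤ k) (γ : PiTerm A) :
    FactorEquiv n γ.pi (γ.npow k) := by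
  induction n generalizing k with
  | zero => trivial
  | succ n ih =>
    obtain ⟨k, rfl⟩ := Nat.exists_eq_add_of_le' h
    have hk := ih (show n ≤ k + n by omega)
    refine ⟨(alph_npow_succ γ _).symm, fun a (ha : a ∈ γ.alph) => ?_⟩
    obtain ⟨-, -, h3, h4⟩ := (npow_succ (n + 1) γ (k + n)).2 a
      ((alph_npow_succ γ (k + n)).symm ▸ ha)
    simp only [YL, YR, ha, if_true] at h3 h4
    refine ⟨?_, ?_, (hk.mul (refl n _)).trans h3.symm, h4.symm⟩
    · simp [npow, XL, ha, refl]
    · simpa [npow, XR, ha] using (refl n _).mul hk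

theorem pi_absorb (n : ℕ) {w y : PiTerm A} (h : y.alph ⊆ w.alph) :
    FactorEquiv n (w.pi.mul (y.mul w.pi)) w.pi := by
  induction n with
  | zero => trivial
  | succ n ih =>
    have e : (w.pi.mul (y.mul w.pi)).alph = w.pi.alph := by
      simp only [alph]
      rw [Set.union_eq_right.2 h, Set.union_self]
    refine ⟨e, fun a ha => ?_⟩
    have c : a ∈ w.pi.alph := e ▸ ha
    have d : a ∈ (y.mul w.pi).alph := Or.inr c
    simp only [XL, XR, YL, YR, c, d, if_true]
    refine ⟨refl n _, (assoc n _ _ _).trans ((refl n _).mul ih), ?_, refl n _⟩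
    exact ((((refl n _).mul (assoc n _ _ _).symm).trans (assoc n _ _ _).symm).trans
      (ih.mul (refl n _)))

end FactorEquiv

/-- The π-free term of a finite word. -/
def ofWord : List A → PiTerm A
  | [] => eps
  | a :: l => (letter a).mul (ofWord l)

theorem mem_alph_ofWord {a : A} {l : List A} : a ∈ (ofWord l).alph ↔ a ∈ l := by
  induction l with
  | nil => simp [ofWord, alph]
  | cons b l ih => simp [ofWord, alph, ih]

namespace FactorEquiv

theorem ofWord_append (n : ℕ) (u v : List A) :
    FactorEquiv n (ofWord (u ++ v)) ((ofWord u).mul (ofWord v)) := by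
  induction u with
  | nil => exact (eps_mul n _).symm
  | cons a u ih => exact ((refl n _).mul ih).trans (assoc n _ _ _).symm

theorem ofWord_listNPow (n : ℕ) (l : List A) (k : ℕ) :
    FactorEquiv n (ofWord (listNPow l k)) ((ofWord l).npow k) := by
  induction k with
  | zero => exact refl n _
  | succ k ih => exact (ofWord_append n _ _).trans ((refl n _).mul ih)

theorem ofWord_substNat {n k : ℕ} (h : n ≤ k) (α : PiTerm A) :
    FactorEquiv n α (ofWord (α.substNat k)) := by
  induction α with
  | eps => exact refl n _
  | letter a => exact (mul_eps n _).symm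
  | mul α β ihα ihβ => exact (ihα.mul ihβ).trans (ofWord_append n _ _).symm
  | pi γ ih =>
    exact ((pi_npow h γ).trans (ih.npow_congr k)).trans (ofWord_listNPow n _ k).symm

theorem mem_iff_of_ofWord {n : ℕ} {u v : List A} (h : FactorEquiv (n + 1) (ofWord u) (ofWord v))
    (a : A) : a ∈ u ↔ a ∈ v := by
  rw [← mem_alph_ofWord, ← mem_alph_ofWord, h.1]

theorem split_first {n : ℕ} {u u' v v' : List A} {a : A}
    (h : FactorEquiv (n + 1) (ofWord (u ++ a :: v)) (ofWord (u' ++ a :: v')))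
    (hu : a ∉ u) (hu' : a ∉ u') :
    FactorEquiv n (ofWord u) (ofWord u') ∧ FactorEquiv n (ofWord v) (ofWord v') := by
  have h := ((ofWord_append _ u (a :: v)).symm.trans h).trans (ofWord_append _ u' (a :: v'))
  obtain ⟨h1, h2, -⟩ := h.2 a (by simp [alph, ofWord])
  simp only [XL, XR, mem_alph_ofWord, hu, hu', ofWord, alph, Set.mem_singleton_iff,
    if_true, if_false] at h1 h2
  exact ⟨((mul_eps n _).symm.trans h1).trans (mul_eps n _),
    ((eps_mul n _).symm.trans h2).trans (eps_mul n _)⟩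

theorem split_last {n : ℕ} {u u' v v' : List A} {a : A}
    (h : FactorEquiv (n + 1) (ofWord (u ++ a :: v)) (ofWord (u' ++ a :: v')))
    (hv : a ∉ v) (hv' : a ∉ v') :
    FactorEquiv n (ofWord u) (ofWord u') ∧ FactorEquiv n (ofWord v) (ofWord v') := by
  have h := ((ofWord_append _ u (a :: v)).symm.trans h).trans (ofWord_append _ u' (a :: v'))
  obtain ⟨-, -, h1, h2⟩ := h.2 a (by simp [alph, ofWord])
  simp only [YL, YR, mem_alph_ofWord, hv, hv', ofWord, alph,
    Set.singleton_union, Set.mem_insert_iff, true_or, if_true, if_false] at h1 h2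
  exact ⟨((mul_eps n _).symm.trans h1).trans (mul_eps n _),
    ((eps_mul n _).symm.trans h2).trans (eps_mul n _)⟩

end FactorEquiv

end PiTerm

/-! ## Isomorphisms of generalized words -/

namespace GWord

variable {A : Type}

/-- Label-preserving order isomorphism of generalized words. -/
def Iso (u v : GWord A) : Prop := ∃ f : u.P ≃o v.P, ∀ p, v.w (f p) = u.w p

theorem Iso.refl (u : GWord A) : u.Iso u := ⟨OrderIso.refl _, fun _ => rfl⟩

theorem Iso.symm {u v : GWord A} : u.Iso v → v.Iso u := by
  rintro ⟨f, hf⟩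
  exact ⟨f.symm, fun p => by rw [← hf, f.apply_symm_apply]⟩

theorem Iso.trans {u v w : GWord A} : u.Iso v → v.Iso w → u.Iso w := by
  rintro ⟨f, hf⟩ ⟨g, hg⟩
  exact ⟨f.trans g, fun p => (hg _).trans (hf _)⟩

theorem Iso.of_strictMono {u v : GWord A} (f : u.P → v.P) (hf : StrictMono f)
    (hs : Function.Surjective f) (hw : ∀ p, v.w (f p) = u.w p) : u.Iso v :=
  ⟨hf.orderIsoOfSurjective f hs, hw⟩

theorem Iso.alph_eq {u v : GWord A} : u.Iso v → u.alph = v.alph := by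
  rintro ⟨f, hf⟩
  have : u.w = v.w ∘ f := funext fun p => (hf p).symm
  rw [alph, alph, this, f.surjective.range_comp]

theorem Iso.append {u u' v v' : GWord A} : u.Iso u' → v.Iso v' →
    (u.append v).Iso (u'.append v') := by
  rintro ⟨f, hf⟩ ⟨g, hg⟩
  refine ⟨f.sumLexCongr g, ?_⟩
  rintro (p | p)
  · exact hf p
  · exact hg p

theorem append_assoc (u v w : GWord A) :
    ((u.append v).append w).Iso (u.append (v.append w)) := by
  refine ⟨OrderIso.sumLexAssoc u.P v.P w.P, ?_⟩
  rintro ((p | p) | p) <;> rfl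

theorem ofList_nil_append (u : GWord A) : ((ofList []).append u).Iso u := by
  have : IsEmpty (ofList ([] : List A)).P := inferInstanceAs (IsEmpty (Fin 0))
  refine Iso.symm ⟨(OrderIso.emptySumLex (β := (ofList ([] : List A)).P)
    (α := u.P)).symm, fun p => rfl⟩

theorem append_ofList_nil (u : GWord A) : (u.append (ofList [])).Iso u := by
  have : IsEmpty (ofList ([] : List A)).P := inferInstanceAs (IsEmpty (Fin 0))
  refine Iso.symm ⟨(OrderIso.sumLexEmpty (β := (ofList ([] : List A)).P)
    (α := u.P)).symm, fun p => rfl⟩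

theorem alph_append (u v : GWord A) : (u.append v).alph = u.alph ∪ v.alph := by
  ext a
  constructor
  · rintro ⟨p | p, rfl⟩
    · exact Or.inl ⟨p, rfl⟩
    · exact Or.inr ⟨p, rfl⟩
  · rintro (⟨p, rfl⟩ | ⟨p, rfl⟩)
    · exact ⟨toLex (Sum.inl p), rfl⟩
    · exact ⟨toLex (Sum.inr p), rfl⟩

theorem alph_gpow_OO (u : GWord A) : (u.gpow OO).alph = u.alph := by
  ext a
  constructor
  · rintro ⟨p, rfl⟩
    exact ⟨(ofLex p).2, rfl⟩
  · rintro ⟨p, rfl⟩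
    exact ⟨toLex (toLex (Sum.inl 0), p), rfl⟩

theorem append_gpow_OO (u : GWord A) : (u.append (u.gpow OO)).Iso (u.gpow OO) := by
  let g : OO → OO := fun x => match ofLex x with
    | Sum.inl i => toLex (Sum.inl (i + 1))
    | Sum.inr i => toLex (Sum.inr i)
  have hg : StrictMono g := by
    rintro (i | i) (j | j) h
    · exact Sum.Lex.inl_lt_inl_iff.2 (Nat.succ_lt_succ (Sum.Lex.inl_lt_inl_iff.1 h))
    · exact Sum.Lex.inl_lt_inr _ _
    · exact absurd h Sum.Lex.not_inr_lt_inl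
    · exact h
  let f : (u.append (u.gpow OO)).P → (u.gpow OO).P := fun x => match ofLex x with
    | Sum.inl p => toLex (toLex (Sum.inl 0), p)
    | Sum.inr x => toLex (g (ofLex x).1, (ofLex x).2)
  refine Iso.of_strictMono f ?_ ?_ ?_
  · rintro (p | p) (q | q) h
    · exact Prod.Lex.toLex_lt_toLex.2 (Or.inr ⟨rfl, Sum.Lex.inl_lt_inl_iff.1 h⟩)
    · refine Prod.Lex.toLex_lt_toLex.2 (Or.inl ?_)
      obtain ⟨i | i, q⟩ := q
      · exact Sum.Lex.inl_lt_inl_iff.2 (Nat.succ_pos i)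
      · exact Sum.Lex.inl_lt_inr _ _
    · exact absurd h Sum.Lex.not_inr_lt_inl
    · have h := Sum.Lex.inr_lt_inr_iff.1 h
      rcases Prod.Lex.toLex_lt_toLex.1 h with h | ⟨h, h'⟩
      · exact Prod.Lex.toLex_lt_toLex.2 (Or.inl (hg h))
      · exact Prod.Lex.toLex_lt_toLex.2 (Or.inr ⟨congrArg g h, h'⟩)
  · rintro ⟨(_ | i) | i, p⟩
    · exact ⟨toLex (Sum.inl p), rfl⟩
    · exact ⟨toLex (Sum.inr (toLex (toLex (Sum.inl i), p))), rfl⟩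
    · exact ⟨toLex (Sum.inr (toLex (toLex (Sum.inr i), p))), rfl⟩
  · rintro (p | p) <;> rfl

theorem gpow_OO_append (u : GWord A) : ((u.gpow OO).append u).Iso (u.gpow OO) := by
  let g : OO → OO := fun x => match ofLex x with
    | Sum.inl i => toLex (Sum.inl i)
    | Sum.inr i => toLex (Sum.inr (OrderDual.toDual (OrderDual.ofDual i + 1)))
  have hg : StrictMono g := by
    rintro (i | i) (j | j) h
    · exact h
    · exact Sum.Lex.inl_lt_inr _ _
    · exact absurd h Sum.Lex.not_inr_lt_inl
    · exact Sum.Lex.inr_lt_inr_iff.2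
        (OrderDual.toDual_lt_toDual.2 (Nat.succ_lt_succ
          (OrderDual.ofDual_lt_ofDual.2 (Sum.Lex.inr_lt_inr_iff.1 h))))
  let f : ((u.gpow OO).append u).P → (u.gpow OO).P := fun x => match ofLex x with
    | Sum.inl x => toLex (g (ofLex x).1, (ofLex x).2)
    | Sum.inr p => toLex (toLex (Sum.inr (OrderDual.toDual 0)), p)
  refine Iso.of_strictMono f ?_ ?_ ?_
  · rintro (p | p) (q | q) h
    · have h := Sum.Lex.inl_lt_inl_iff.1 h
      rcases Prod.Lex.toLex_lt_toLex.1 h with h | ⟨h, h'⟩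
      · exact Prod.Lex.toLex_lt_toLex.2 (Or.inl (hg h))
      · exact Prod.Lex.toLex_lt_toLex.2 (Or.inr ⟨congrArg g h, h'⟩)
    · refine Prod.Lex.toLex_lt_toLex.2 (Or.inl ?_)
      obtain ⟨i | i, p⟩ := p
      · exact Sum.Lex.inl_lt_inr _ _
      · exact Sum.Lex.inr_lt_inr_iff.2 (OrderDual.toDual_lt_toDual.2 (Nat.succ_pos _))
    · exact absurd h Sum.Lex.not_inr_lt_inl
    · exact Prod.Lex.toLex_lt_toLex.2 (Or.inr ⟨rfl, Sum.Lex.inr_lt_inr_iff.1 h⟩)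
  · rintro ⟨i | (_ | i), p⟩
    · exact ⟨toLex (Sum.inl (toLex (toLex (Sum.inl i), p))), rfl⟩
    · exact ⟨toLex (Sum.inr p), rfl⟩
    · exact ⟨toLex (Sum.inl (toLex (toLex (Sum.inr (OrderDual.toDual i)), p))), rfl⟩
  · rintro (p | p) <;> rfl

theorem Iso.restrict_lt_gt {u l r : GWord A} {a : A}
    (h : u.Iso (l.append ((ofList [a]).append r))) :
    ∃ p, u.w p = a ∧ (u.restrict {q | q < p}).Iso l ∧ (u.restrict {q | p < q}).Iso r ∧
      (a ∉ l.alph → u.IsFirst a p) ∧ (a ∉ r.alph → u.IsLast a p) := by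
  obtain ⟨f, hf⟩ := h
  let il : l.P → (l.append ((ofList [a]).append r)).P := fun y => toLex (Sum.inl y)
  let ir : r.P → (l.append ((ofList [a]).append r)).P :=
    fun y => toLex (Sum.inr (toLex (Sum.inr y)))
  let z : (ofList [a]).P := (0 : Fin 1)
  let c : (l.append ((ofList [a]).append r)).P := toLex (Sum.inr (toLex (Sum.inl z)))
  have hz : ∀ x y : (ofList [a]).P, ¬ x < y := fun x y h =>
    absurd (Subsingleton.elim (α := Fin 1) x y) h.ne
  have hl : ∀ x, x < c ↔ ∃ y, il y = x := by
    rintro (x | (x | x))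
    · exact iff_of_true (Sum.Lex.inl_lt_inr _ _) ⟨x, rfl⟩
    · refine iff_of_false (fun h => ?_) (fun ⟨y, hy⟩ => nomatch hy)
      exact hz _ _ (Sum.Lex.inl_lt_inl_iff.1 (Sum.Lex.inr_lt_inr_iff.1 h))
    · refine iff_of_false (fun h => ?_) (fun ⟨y, hy⟩ => nomatch hy)
      exact absurd (Sum.Lex.inr_lt_inr_iff.1 h) Sum.Lex.not_inr_lt_inl
  have hr : ∀ x, c < x ↔ ∃ y, ir y = x := by
    rintro (x | (x | x))
    · exact iff_of_false Sum.Lex.not_inr_lt_inl (fun ⟨y, hy⟩ => nomatch hy)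
    · refine iff_of_false (fun h => ?_) (fun ⟨y, hy⟩ => nomatch hy)
      exact hz _ _ (Sum.Lex.inl_lt_inl_iff.1 (Sum.Lex.inr_lt_inr_iff.1 h))
    · exact iff_of_true (Sum.Lex.inr_lt_inr_iff.2 (Sum.Lex.inl_lt_inr _ _)) ⟨x, rfl⟩
  have hc : f (f.symm c) = c := f.apply_symm_apply c
  have hw : u.w (f.symm c) = a := by rw [← hf, hc]; rfl
  have hlt : ∀ q, q < f.symm c ↔ ∃ y, il y = f q := fun q => by
    rw [← hl, ← f.lt_iff_lt, hc]
  have hgt : ∀ q, f.symm c < q ↔ ∃ y, ir y = f q := fun q => by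
    rw [← hr, ← f.lt_iff_lt, hc]
  refine ⟨f.symm c, hw, ?_, ?_, fun ha => ⟨hw, fun q hq => not_lt.1 fun h => ha ?_⟩,
    fun ha => ⟨hw, fun q hq => not_lt.1 fun h => ha ?_⟩⟩
  · refine Iso.symm (Iso.of_strictMono (u := l)
      (fun y => ⟨f.symm (il y), (hlt _).2 ⟨y, (f.apply_symm_apply _).symm⟩⟩) ?_ ?_ ?_)
    · intro x y h
      exact f.symm.lt_iff_lt.2 (Sum.Lex.inl_lt_inl_iff.2 h)
    · rintro ⟨q, hq⟩
      obtain ⟨y, hy⟩ := (hlt q).1 hq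
      exact ⟨y, Subtype.ext ((congrArg f.symm hy).trans (f.symm_apply_apply q))⟩
    · intro y
      exact (hf _).symm.trans (congrArg _ (f.apply_symm_apply (il y)))
  · refine Iso.symm (Iso.of_strictMono (u := r)
      (fun y => ⟨f.symm (ir y), (hgt _).2 ⟨y, (f.apply_symm_apply _).symm⟩⟩) ?_ ?_ ?_)
    · intro x y h
      exact f.symm.lt_iff_lt.2 (Sum.Lex.inr_lt_inr_iff.2 (Sum.Lex.inr_lt_inr_iff.2 h))
    · rintro ⟨q, hq⟩
      obtain ⟨y, hy⟩ := (hgt q).1 hq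
      exact ⟨y, Subtype.ext ((congrArg f.symm hy).trans (f.symm_apply_apply q))⟩
    · intro y
      exact (hf _).symm.trans (congrArg _ (f.apply_symm_apply (ir y)))
  · obtain ⟨y, hy⟩ := (hlt q).1 h
    exact ⟨y, by rw [← hq, ← hf, ← hy]; rfl⟩
  · obtain ⟨y, hy⟩ := (hgt q).1 h
    exact ⟨y, by rw [← hq, ← hf, ← hy]; rfl⟩

theorem IsFirst.XL_eq {u : GWord A} {a : A} {p : u.P} (h : u.IsFirst a p) :
    u.XL a = u.restrict {q | q < p} ∧ u.XR a = u.restrict {q | p < q} := by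
  have hex : ∃ p, u.IsFirst a p := ⟨p, h⟩
  have e : hex.choose = p :=
    le_antisymm (hex.choose_spec.2 p h.1) (h.2 _ hex.choose_spec.1)
  simp only [XL, XR, dif_pos hex, e, and_self]

theorem IsLast.YL_eq {u : GWord A} {a : A} {p : u.P} (h : u.IsLast a p) :
    u.YL a = u.restrict {q | q < p} ∧ u.YR a = u.restrict {q | p < q} := by
  have hex : ∃ p, u.IsLast a p := ⟨p, h⟩
  have e : hex.choose = p :=
    le_antisymm (h.2 _ hex.choose_spec.1) (hex.choose_spec.2 p h.1)
  simp only [YL, YR, dif_pos hex, e, and_self]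

theorem Iso.XL_XR {u l r : GWord A} {a : A} (h : u.Iso (l.append ((ofList [a]).append r)))
    (ha : a ∉ l.alph) : (u.XL a).Iso l ∧ (u.XR a).Iso r := by
  obtain ⟨p, -, hl, hr, hp, -⟩ := h.restrict_lt_gt
  rw [(hp ha).XL_eq.1, (hp ha).XL_eq.2]
  exact ⟨hl, hr⟩

theorem Iso.YL_YR {u l r : GWord A} {a : A} (h : u.Iso (l.append ((ofList [a]).append r)))
    (ha : a ∉ r.alph) : (u.YL a).Iso l ∧ (u.YR a).Iso r := by
  obtain ⟨p, -, hl, hr, -, hp⟩ := h.restrict_lt_gt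
  rw [(hp ha).YL_eq.1, (hp ha).YL_eq.2]
  exact ⟨hl, hr⟩

end GWord

/-! ## Reduction of the relations to factorizations of π-terms -/

namespace PiTerm

variable {A : Type}

theorem alph_substOO (α : PiTerm A) : α.substOO.alph = α.alph := by
  induction α with
  | eps => exact Set.range_eq_empty (ι := Fin 0) _
  | letter a =>
    ext b
    exact ⟨fun ⟨i, hi⟩ => by rw [← hi, Subsingleton.elim (α := Fin 1) i 0]; rfl,
      fun h => ⟨(0 : Fin 1), h.symm⟩⟩
  | mul α β ihα ihβ => rw [substOO, GWord.alph_append, ihα, ihβ, alph]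
  | pi γ ih => rw [substOO, GWord.alph_gpow_OO, ih, alph]

theorem notMem_alph_XL (a : A) (α : PiTerm A) : a ∉ (α.XL a).alph := by
  induction α with
  | eps => exact id
  | letter b => exact id
  | mul α β ihα ihβ =>
    rw [XL]
    split_ifs with c
    · exact ihα
    · exact fun h => h.elim c ihβ
  | pi γ ih => exact ih

theorem notMem_alph_YR (a : A) (α : PiTerm A) : a ∉ (α.YR a).alph := by
  induction α with
  | eps => exact id
  | letter b => exact id
  | mul α β ihα ihβ =>
    rw [YR]
    split_ifs with c
    · exact ihβ
    · exact fun h => h.elim ihα c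
  | pi γ ih => exact ih

open GWord in
theorem substOO_iso_first {a : A} {α : PiTerm A} (ha : a ∈ α.alph) :
    α.substOO.Iso ((α.XL a).substOO.append ((ofList [a]).append (α.XR a).substOO)) := by
  induction α with
  | eps => exact ha.elim
  | letter b =>
    obtain rfl : a = b := ha
    exact ((ofList_nil_append _).trans (append_ofList_nil _)).symm
  | mul α β ihα ihβ =>
    rw [XL, XR]
    split_ifs with c
    · exact ((ihα c).append (.refl _)).trans ((append_assoc _ _ _).trans
        ((Iso.refl _).append (append_assoc _ _ _)))
    · exact ((Iso.refl _).append (ihβ (ha.resolve_left c))).trans (append_assoc _ _ _).symm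
  | pi γ ih =>
    exact (append_gpow_OO _).symm.trans (((ih ha).append (.refl _)).trans
      ((append_assoc _ _ _).trans ((Iso.refl _).append (append_assoc _ _ _))))

open GWord in
theorem substOO_iso_last {a : A} {α : PiTerm A} (ha : a ∈ α.alph) :
    α.substOO.Iso ((α.YL a).substOO.append ((ofList [a]).append (α.YR a).substOO)) := by
  induction α with
  | eps => exact ha.elim
  | letter b =>
    obtain rfl : a = b := ha
    exact ((ofList_nil_append _).trans (append_ofList_nil _)).symm
  | mul α β ihα ihβ =>
    rw [YL, YR]
    split_ifs with c
    · exact ((Iso.refl _).append (ihβ c)).trans (append_assoc _ _ _).symm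
    · exact ((ihα (ha.resolve_right c)).append (.refl _)).trans ((append_assoc _ _ _).trans
        ((Iso.refl _).append (append_assoc _ _ _)))
  | pi γ ih =>
    exact (gpow_OO_append _).symm.trans
      (((Iso.refl _).append (ih ha)).trans (append_assoc _ _ _).symm)

end PiTerm

namespace GWord

variable {A : Type}

/-- Equivalence of generalized words under all nested factorizations of depth less than `n`. -/
def FactorEquiv : ℕ → GWord A → GWord A → Prop
  | 0, _, _ => True
  | n + 1, u, v => u.alph = v.alph ∧ ∀ a ∈ u.alph,
      FactorEquiv n (u.XL a) (v.XL a) ∧ FactorEquiv n (u.XR a) (v.XR a) ∧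
      FactorEquiv n (u.YL a) (v.YL a) ∧ FactorEquiv n (u.YR a) (v.YR a)

theorem FactorEquiv.pred {n : ℕ} {u v : GWord A} (h : FactorEquiv (n + 1) u v) :
    FactorEquiv n u v := by
  induction n generalizing u v with
  | zero => trivial
  | succ n ih =>
    refine ⟨h.1, fun a ha => ?_⟩
    obtain ⟨h1, h2, h3, h4⟩ := h.2 a ha
    exact ⟨ih h1, ih h2, ih h3, ih h4⟩

theorem factorEquiv_iff_of_iso {n : ℕ} {u v : GWord A} {α β : PiTerm A}
    (hu : u.Iso α.substOO) (hv : v.Iso β.substOO) :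
    FactorEquiv n u v ↔ PiTerm.FactorEquiv n α β := by
  induction n generalizing u v α β with
  | zero => exact Iff.rfl
  | succ n ih =>
    have eu : u.alph = α.alph := hu.alph_eq.trans α.alph_substOO
    have ev : v.alph = β.alph := hv.alph_eq.trans β.alph_substOO
    rw [FactorEquiv, PiTerm.FactorEquiv, eu, ev]
    refine and_congr_right fun e => forall₂_congr fun a ha => ?_
    have hb : a ∈ β.alph := e ▸ ha
    obtain ⟨u1, u2⟩ := (hu.trans (PiTerm.substOO_iso_first ha)).XL_XR
      (by rw [PiTerm.alph_substOO]; exact α.notMem_alph_XL a)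
    obtain ⟨u3, u4⟩ := (hu.trans (PiTerm.substOO_iso_last ha)).YL_YR
      (by rw [PiTerm.alph_substOO]; exact α.notMem_alph_YR a)
    obtain ⟨v1, v2⟩ := (hv.trans (PiTerm.substOO_iso_first hb)).XL_XR
      (by rw [PiTerm.alph_substOO]; exact β.notMem_alph_XL a)
    obtain ⟨v3, v4⟩ := (hv.trans (PiTerm.substOO_iso_last hb)).YL_YR
      (by rw [PiTerm.alph_substOO]; exact β.notMem_alph_YR a)
    rw [ih u1 v1, ih u2 v2, ih u3 v3, ih u4 v4]

theorem FactorEquiv.eqvAux {n : ℕ} {u v : GWord A} (h : FactorEquiv n u v) (m : ℕ) :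
    eqvAux n ZK.X m u v ∧ eqvAux n ZK.Y m u v := by
  induction n generalizing m u v with
  | zero => exact ⟨trivial, trivial⟩
  | succ n ih =>
    cases m with
    | zero => exact ⟨trivial, trivial⟩
    | succ m =>
      refine ⟨⟨h.1, (ih h.pred m).2, fun a ha => ?_⟩, ⟨h.1, (ih h.pred m).1, fun a ha => ?_⟩⟩
      · exact ⟨(ih (h.2 a ha).1 m).2, (ih (h.2 a ha).2.1 _).1⟩
      · exact ⟨(ih (h.2 a ha).2.2.1 _).2, (ih (h.2 a ha).2.2.2 m).1⟩

theorem factorEquiv_of_eqvAux {n m k : ℕ} {u v : GWord A} (hm : 2 * n ≤ m) (hk : 2 * n ≤ k)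
    (h : eqvAux k ZK.X m u v ∨ eqvAux k ZK.Y m u v) : FactorEquiv n u v := by
  induction n generalizing m k u v with
  | zero => trivial
  | succ n ih =>
    obtain ⟨m, rfl⟩ := Nat.exists_eq_add_of_le' (show 2 ≤ m by omega)
    obtain ⟨k, rfl⟩ := Nat.exists_eq_add_of_le' (show 2 ≤ k by omega)
    rcases h with ⟨h, h', h''⟩ | ⟨h, h', h''⟩
    · refine ⟨h, fun a ha => ⟨ih ?_ ?_ (.inr (h'' a ha).1), ih ?_ ?_ (.inl (h'' a ha).2),
        ih ?_ ?_ (.inr (h'.2.2 a ha).1), ih ?_ ?_ (.inl (h'.2.2 a ha).2)⟩⟩ <;> omega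
    · refine ⟨h, fun a ha => ⟨ih ?_ ?_ (.inr (h'.2.2 a ha).1), ih ?_ ?_ (.inl (h'.2.2 a ha).2),
        ih ?_ ?_ (.inr (h'' a ha).1), ih ?_ ?_ (.inl (h'' a ha).2)⟩⟩ <;> omega

end GWord

theorem forall_wEquiv_XY_iff {A : Type} (α β : PiTerm A) :
    (∀ m n : ℕ, wEquiv ZKind.XY m n α.substOO β.substOO) ↔
      ∀ n, PiTerm.FactorEquiv n α β := by
  constructor
  · exact fun h n => (GWord.factorEquiv_iff_of_iso (.refl _) (.refl _)).1
      (GWord.factorEquiv_of_eqvAux le_rfl le_rfl (.inl (h (2 * n) (2 * n)).1))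
  · exact fun h m n =>
      ((GWord.factorEquiv_iff_of_iso (.refl _) (.refl _)).2 (h n)).eqvAux m

/-! ## Powers in finite monoids -/

theorem monoidExp_mem (M : Type) [Monoid M] [Finite M] :
    1 ≤ monoidExp M ∧ ∀ x : M, IsIdempotentElem (x ^ monoidExp M) := by
  refine Nat.sInf_mem (s := {n : ℕ | 1 ≤ n ∧ ∀ x : M, IsIdempotentElem (x ^ n)}) ?_
  have hx : ∀ x : M, ∃ n : ℕ, 1 ≤ n ∧ IsIdempotentElem (x ^ n) := by
    intro x
    obtain ⟨i, j, hij, h⟩ : ∃ i j : ℕ, i < j ∧ x ^ i = x ^ j := by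
      obtain ⟨i, j, hne, h⟩ := Finite.exists_ne_map_eq_of_infinite (fun i : ℕ => x ^ i)
      rcases lt_or_gt_of_ne hne with hlt | hlt
      · exact ⟨i, j, hlt, h⟩
      · exact ⟨j, i, hlt, h.symm⟩
    obtain ⟨d, rfl⟩ := Nat.exists_eq_add_of_lt hij
    have shift : ∀ s k : ℕ, i ≤ s → x ^ (s + k * (d + 1)) = x ^ s := by
      intro s k hs
      induction k with
      | zero => simp
      | succ k ih =>
        obtain ⟨r, rfl⟩ := Nat.exists_eq_add_of_le hs
        rw [← ih, show i + r + (k + 1) * (d + 1) = i + d + 1 + (r + k * (d + 1)) by ring,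
          pow_add, ← h, ← pow_add, add_assoc]
    refine ⟨(i + 1) * (d + 1), Nat.mul_pos i.succ_pos d.succ_pos, ?_⟩
    rw [IsIdempotentElem, ← pow_add]
    exact shift _ _ (by nlinarith)
  choose f hf hf' using hx
  have := Fintype.ofFinite M
  refine ⟨∏ x, f x, Nat.succ_le_of_lt (Finset.prod_pos fun x _ => hf x), fun x => ?_⟩
  rw [← Finset.mul_prod_erase Finset.univ f (Finset.mem_univ x), pow_mul]
  exact (hf' x).pow _

theorem listNPow_toFreeMonoid {A : Type} (l : List A) (k : ℕ) :
    FreeMonoid.ofList (listNPow l k) = FreeMonoid.ofList l ^ k := by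
  induction k with
  | zero => rfl
  | succ k ih => rw [pow_succ', ← ih]; rfl

theorem map_substNat_mul {A M : Type} [Monoid M] (σ : FreeMonoid A →* M) {N k : ℕ}
    (hN : ∀ x : M, IsIdempotentElem (x ^ N)) (hk : k ≠ 0) (α : PiTerm A) :
    σ (FreeMonoid.ofList (α.substNat (N * k))) = σ (FreeMonoid.ofList (α.substNat N)) := by
  induction α with
  | eps => rfl
  | letter a => rfl
  | mul α β ihα ihβ =>
    simp only [PiTerm.substNat, FreeMonoid.ofList_append, map_mul, ihα, ihβ]
  | pi γ ih =>
    simp only [PiTerm.substNat, listNPow_toFreeMonoid, map_pow, ih]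
    rw [pow_mul, (hN _).pow_eq hk]

/-! ## The finite quotients of the free monoid belong to DA -/

namespace PiTerm

variable {A : Type}

/-- Factor equivalence of π-terms as a setoid. -/
def factorSetoid (A : Type) (n : ℕ) : Setoid (PiTerm A) :=
  ⟨FactorEquiv n, FactorEquiv.refl n, FactorEquiv.symm, FactorEquiv.trans⟩

theorem finite_quotient_factorSetoid [Finite A] (n : ℕ) :
    Finite (Quotient (factorSetoid A n)) := by
  induction n with
  | zero =>
    have : Subsingleton (Quotient (factorSetoid A 0)) :=
      ⟨fun p q => Quotient.inductionOn₂ p q fun _ _ => Quotient.sound trivial⟩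
    infer_instance
  | succ n ih =>
    let c : PiTerm A → Quotient (factorSetoid A n) := Quotient.mk _
    let f : PiTerm A → Set A × (A → Quotient (factorSetoid A n) × Quotient (factorSetoid A n) ×
        Quotient (factorSetoid A n) × Quotient (factorSetoid A n)) :=
      fun α => (α.alph, fun a => (c (α.XL a), c (α.XR a), c (α.YL a), c (α.YR a)))
    refine Finite.of_injective (fun q : Quotient (factorSetoid A (n + 1)) => f q.out) ?_
    intro p q h
    refine Quotient.out_equiv_out.1 ⟨congrArg Prod.fst h, fun a _ => ?_⟩
    have ha := congrFun (congrArg Prod.snd h) a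
    simp only [f, Prod.mk.injEq] at ha
    exact ⟨Quotient.exact ha.1, Quotient.exact ha.2.1, Quotient.exact ha.2.2.1,
      Quotient.exact ha.2.2.2⟩

/-- Factor equivalence of finite words as a congruence. -/
def factorCon (A : Type) (n : ℕ) : Con (FreeMonoid A) where
  r u v := FactorEquiv n (ofWord u.toList) (ofWord v.toList)
  iseqv := ⟨fun _ => .refl n _, .symm, .trans⟩
  mul' {u u' v v'} h h' := by
    rw [FreeMonoid.toList_mul, FreeMonoid.toList_mul]
    exact ((FactorEquiv.ofWord_append n _ _).trans (h.mul h')).trans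
      (FactorEquiv.ofWord_append n _ _).symm

instance [Finite A] (n : ℕ) : Finite (factorCon A n).Quotient := by
  have := finite_quotient_factorSetoid (A := A) n
  refine Finite.of_injective (fun q : (factorCon A n).Quotient =>
    (Quotient.mk (factorSetoid A n) (ofWord (Quotient.out q).toList))) ?_
  intro p q h
  have h : FactorEquiv n (ofWord (Quotient.out p).toList) (ofWord (Quotient.out q).toList) :=
    Quotient.exact h
  exact Quotient.out_equiv_out.1 h

theorem inDA_factorCon [Finite A] (n : ℕ) : InDA (factorCon A n).Quotient := by
  intro x y z
  obtain ⟨hN, hidem⟩ := monoidExp_mem (factorCon A n).Quotient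
  set N := monoidExp (factorCon A n).Quotient
  induction x using Con.induction_on with | _ u
  induction y using Con.induction_on with | _ v
  induction z using Con.induction_on with | _ w
  have hK : n ≤ N * (n + 1) := by nlinarith
  rw [← (hidem _).pow_eq n.succ_ne_zero, ← pow_mul]
  have coe_pow : ∀ (g : FreeMonoid A) (k : ℕ), (g : (factorCon A n).Quotient) ^ k = ↑(g ^ k) :=
    fun g k => (map_pow (factorCon A n).mk' g k).symm
  simp only [← Con.coe_mul, coe_pow]
  refine (Con.eq _).2 ?_
  set p := u * v * w with hp
  have hpow : FactorEquiv n (ofWord (p ^ (N * (n + 1))).toList) (ofWord p.toList).pi := by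
    have h : p ^ (N * (n + 1)) = FreeMonoid.ofList (listNPow p.toList (N * (n + 1))) :=
      (listNPow_toFreeMonoid _ _).symm
    rw [h]
    exact (FactorEquiv.ofWord_listNPow n _ _).trans (FactorEquiv.pi_npow hK _).symm
  have hsub : (ofWord v.toList).alph ⊆ (ofWord p.toList).alph := by
    intro a ha
    rw [mem_alph_ofWord] at ha ⊢
    simp [hp, FreeMonoid.toList_mul, ha]
  have h1 : FactorEquiv n (ofWord (p ^ (N * (n + 1)) * v * p ^ (N * (n + 1))).toList)
      ((ofWord p.toList).pi.mul ((ofWord v.toList).mul (ofWord p.toList).pi)) := by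
    rw [mul_assoc, FreeMonoid.toList_mul, FreeMonoid.toList_mul]
    exact (FactorEquiv.ofWord_append n _ _).trans (hpow.mul
      ((FactorEquiv.ofWord_append n _ _).trans ((FactorEquiv.refl n _).mul hpow)))
  exact (h1.trans (FactorEquiv.pi_absorb n hsub)).trans hpow.symm

theorem factorEquiv_of_forall_DA [Finite A] {α β : PiTerm A}
    (h : ∀ (M : Type) [Monoid M] [Finite M], InDA M → EqHoldsIn α β M) (n : ℕ) :
    FactorEquiv n α β := by
  obtain ⟨hN, hidem⟩ := monoidExp_mem (factorCon A n).Quotient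
  have hK : n ≤ monoidExp (factorCon A n).Quotient * (n + 1) := by nlinarith
  have e := h _ (inDA_factorCon n) (factorCon A n).mk'
  rw [← map_substNat_mul _ hidem n.succ_ne_zero α,
    ← map_substNat_mul _ hidem n.succ_ne_zero β] at e
  have e : FactorEquiv n _ _ := (Con.eq _).1 e
  exact ((FactorEquiv.ofWord_substNat hK α).trans e).trans (FactorEquiv.ofWord_substNat hK β).symm

end PiTerm

/-! ## Finite monoids in DA recognize only unions of classes -/

section DA

variable {A M : Type} [Monoid M] {N : ℕ}

theorem mul_pow_eq_of_mul_eq {s p : M} (h : s * p = s) (k : ℕ) : s * p ^ k = s := by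
  induction k with
  | zero => simp
  | succ k ih => rw [pow_succ', ← mul_assoc, h, ih]

theorem exists_mul_prod_mul_eq_of_subset
    (hDA : ∀ x y z : M, (x * y * z) ^ N * y * (x * y * z) ^ N = (x * y * z) ^ N)
    (φ : A → M) {s : M} {w v : List A} (hw : ∃ t, s * (w.map φ).prod * t = s) (hv : v ⊆ w) :
    ∃ t, s * (v.map φ).prod * t = s := by
  induction v using List.reverseRecOn with
  | nil => exact ⟨1, by simp⟩
  | append_singleton v b ih =>
    obtain ⟨t, ht⟩ := ih fun a ha => hv (List.mem_append_left _ ha)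
    obtain ⟨r, hr⟩ := hw
    obtain ⟨w₁, w₂, rfl⟩ := List.append_of_mem (hv (List.mem_append_right _ List.mem_cons_self))
    set y := (v.map φ).prod
    let p := t * (w₁.map φ).prod * φ b * ((w₂.map φ).prod * r * y)
    have hp : s * y * p = s * y := by
      calc s * y * p = s * y * t * ((w₁ ++ b :: w₂).map φ).prod * r * y := by
            simp [p, mul_assoc]
        _ = s * y := by rw [ht, hr]
    have hpN := mul_pow_eq_of_mul_eq hp N
    refine ⟨p ^ N * t, ?_⟩
    calc s * ((v ++ [b]).map φ).prod * (p ^ N * t)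
        = s * y * φ b * p ^ N * t := by simp [y, mul_assoc]
      _ = s * y * p ^ N * φ b * p ^ N * t := by rw [hpN]
      _ = s * y * (p ^ N * φ b * p ^ N) * t := by simp only [mul_assoc]
      _ = s := by rw [hDA, hpN, ht]

theorem exists_first_descent (φ : A → M) {s : M} {u : List A}
    (hu : ¬ ∃ t, s * (u.map φ).prod * t = s) :
    ∃ u₁ a u₂, u = u₁ ++ a :: u₂ ∧ (∃ t, s * (u₁.map φ).prod * t = s) ∧
      ¬ ∃ t, s * ((u₁ ++ [a]).map φ).prod * t = s := by
  induction u using List.reverseRecOn with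
  | nil => exact absurd ⟨1, by simp⟩ hu
  | append_singleton u b ih =>
    by_cases h : ∃ t, s * (u.map φ).prod * t = s
    · exact ⟨u, b, [], rfl, h, hu⟩
    · obtain ⟨u₁, a, u₂, rfl, h₁, h₂⟩ := ih h
      exact ⟨u₁, a, u₂ ++ [b], by simp, h₁, h₂⟩

theorem exists_mul_prod_mul_eq [Finite M]
    (hDA : ∀ x y z : M, (x * y * z) ^ N * y * (x * y * z) ^ N = (x * y * z) ^ N)
    (φ : A → M) {E : ℕ → List A → List A → Prop}
    (hmem : ∀ {n u v}, E (n + 1) u v → ∀ a, a ∈ u ↔ a ∈ v)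
    (hsplit : ∀ {n u u' v v' a}, E (n + 1) (u ++ a :: v) (u' ++ a :: v') → a ∉ u → a ∉ u' →
      E n u u' ∧ E n v v')
    {k n₀ : ℕ} (hk : ∀ n ≥ n₀, ∀ u v, u.toFinset.card ≤ k → E n u v →
      (u.map φ).prod = (v.map φ).prod)
    {j : ℕ} {s : M} (hs : (Set.range (s * ·)).ncard ≤ j) {u v : List A}
    (hu : u.toFinset.card ≤ k + 1) (h : E (n₀ + j) u v) :
    ∃ t, s * (v.map φ).prod * t = s * (u.map φ).prod := by
  induction j generalizing s u v with
  | zero =>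
    have := (Set.ncard_pos (Set.toFinite _)).2 (Set.range_nonempty (s * ·))
    omega
  | succ j ih =>
    by_cases hR : ∃ t, s * (u.map φ).prod * t = s
    · obtain ⟨t, ht⟩ := exists_mul_prod_mul_eq_of_subset hDA φ hR
        (fun a ha => (hmem h a).2 ha : v ⊆ u)
      exact ⟨t * (u.map φ).prod, by rw [← mul_assoc, ht]⟩
    · obtain ⟨u₁, a, u₂, rfl, h₁, h₂⟩ := exists_first_descent φ hR
      have ha : a ∉ u₁ := fun ha =>
        h₂ (exists_mul_prod_mul_eq_of_subset hDA φ h₁ (by simp [ha]))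
      obtain ⟨v₁, v₂, rfl, ha'⟩ := List.eq_append_cons_of_mem ((hmem h a).1 (by simp))
      obtain ⟨e₁, e₂⟩ := hsplit h ha ha'
      have hcard : u₁.toFinset.card < (u₁ ++ a :: u₂).toFinset.card :=
        Finset.card_lt_card ((Finset.ssubset_iff_of_subset fun b hb => by
          simp only [List.mem_toFinset] at hb ⊢
          exact List.mem_append_left _ hb).2 ⟨a, by simp, by simpa using ha⟩)
      have hprod := hk _ (Nat.le_add_right _ _) u₁ v₁ (by omega) e₁
      have hlt : (Set.range (s * (u₁.map φ).prod * φ a * ·)).ncard <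
          (Set.range (s * ·)).ncard := by
        refine Set.ncard_lt_ncard ((Set.ssubset_iff_of_subset ?_).2 ⟨s, ⟨1, mul_one s⟩, ?_⟩)
          (Set.toFinite _)
        · rintro _ ⟨t, rfl⟩
          exact ⟨(u₁.map φ).prod * φ a * t, by simp only [mul_assoc]⟩
        · rintro ⟨t, ht⟩
          exact h₂ ⟨t, by simpa [mul_assoc] using ht⟩
      have hsub : u₂.toFinset.card ≤ (u₁ ++ a :: u₂).toFinset.card :=
        Finset.card_le_card fun b hb => by
          simp only [List.mem_toFinset] at hb ⊢
          exact List.mem_append_right _ (List.mem_cons_of_mem _ hb)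
      obtain ⟨t, ht⟩ := ih (s := s * (u₁.map φ).prod * φ a) (by omega) (hsub.trans hu) e₂
      exact ⟨t, by simpa [mul_assoc, ← hprod] using ht⟩

theorem eq_of_mul_eq_of_mul_eq
    (hDA : ∀ x y z : M, (x * y * z) ^ N * y * (x * y * z) ^ N = (x * y * z) ^ N)
    (hN : ∀ x : M, IsIdempotentElem (x ^ N)) {x y r t : M} (hr : r * y = x) (ht : x * t = y) :
    x = y := by
  have haper : t ^ N * t = t ^ N := by
    have h := hDA 1 t 1
    rw [one_mul, mul_one, ← pow_succ, pow_succ', mul_assoc, (hN t).eq, ← pow_succ', pow_succ] at h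
    exact h
  have hpow : ∀ i, r ^ i * x * t ^ i = x := by
    intro i
    induction i with
    | zero => simp
    | succ i ih =>
      calc r ^ (i + 1) * x * t ^ (i + 1) = r ^ i * (r * (x * t)) * t ^ i := by
            rw [pow_succ, pow_succ']; simp only [mul_assoc]
        _ = x := by rw [ht, hr, ih]
  calc x = r ^ N * x * (t ^ N * t) := by rw [haper, hpow]
    _ = y := by rw [← mul_assoc, hpow, ht]

theorem unop_prod_map_op (φ : A → M) (l : List A) :
    ((l.map fun a => MulOpposite.op (φ a)).prod).unop = (l.reverse.map φ).prod := by
  induction l with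
  | nil => rfl
  | cons a l ih => simp [ih]

open PiTerm in
theorem exists_factorEquiv_prod_eq [Finite M]
    (hDA : ∀ x y z : M, (x * y * z) ^ N * y * (x * y * z) ^ N = (x * y * z) ^ N)
    (hN : ∀ x : M, IsIdempotentElem (x ^ N)) (φ : A → M) (k : ℕ) :
    ∃ n₀, ∀ n ≥ n₀, ∀ u v : List A, u.toFinset.card ≤ k →
      FactorEquiv n (ofWord u) (ofWord v) → (u.map φ).prod = (v.map φ).prod := by
  induction k with
  | zero =>
    refine ⟨1, fun n hn u v hu h => ?_⟩
    obtain ⟨n, rfl⟩ := Nat.exists_eq_add_of_le' hn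
    have hu : u = [] := by simpa using hu
    have hv : v = [] := List.eq_nil_iff_forall_not_mem.2 fun a ha => by
      simpa [hu] using (h.mem_iff_of_ofWord a).2 ha
    rw [hu, hv]
  | succ k ih =>
    obtain ⟨n₀, hk⟩ := ih
    have : Finite Mᵐᵒᵖ := Finite.of_equiv M MulOpposite.opEquiv
    have hDA' : ∀ x y z : Mᵐᵒᵖ, (x * y * z) ^ N * y * (x * y * z) ^ N = (x * y * z) ^ N := by
      intro x y z
      apply MulOpposite.unop_injective
      simpa [mul_assoc] using hDA z.unop y.unop x.unop
    have right : ∀ j ≥ Nat.card M, ∀ u v : List A, u.toFinset.card ≤ k + 1 →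
        FactorEquiv (n₀ + j) (ofWord u) (ofWord v) →
        ∃ t, (v.map φ).prod * t = (u.map φ).prod := by
      intro j hj u v hu h
      simpa using exists_mul_prod_mul_eq hDA φ
        (E := fun n u v => FactorEquiv n (ofWord u) (ofWord v))
        FactorEquiv.mem_iff_of_ofWord FactorEquiv.split_first hk
        (s := 1) ((Set.ncard_le_card _).trans hj) hu h
    have left : ∀ j ≥ Nat.card M, ∀ u v : List A, u.toFinset.card ≤ k + 1 →
        FactorEquiv (n₀ + j) (ofWord u) (ofWord v) →
        ∃ t, t * (v.map φ).prod = (u.map φ).prod := by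
      intro j hj u v hu h
      obtain ⟨t, ht⟩ := exists_mul_prod_mul_eq hDA' (fun a => MulOpposite.op (φ a))
        (E := fun n u v => FactorEquiv n (ofWord u.reverse) (ofWord v.reverse))
        (fun h a => by simpa using h.mem_iff_of_ofWord a)
        (fun {n u u' v v' a} h hu hu' => by
          simp only [List.reverse_append, List.reverse_cons, List.append_assoc,
            List.singleton_append] at h
          exact (h.split_last (by simpa using hu) (by simpa using hu')).symm)
        (fun n hn u v hu h => MulOpposite.unop_injective (by
          rw [unop_prod_map_op, unop_prod_map_op]
          exact hk n hn _ _ (by simpa using hu) h))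
        (s := 1) (j := j) (u := u.reverse) (v := v.reverse)
        ((Set.ncard_le_card _).trans
          ((Nat.card_congr MulOpposite.opEquiv.symm).le.trans hj)) (by simpa using hu)
        (by simpa using h)
      refine ⟨t.unop, ?_⟩
      have := congrArg MulOpposite.unop ht
      simpa only [one_mul, MulOpposite.unop_mul, unop_prod_map_op, List.reverse_reverse] using this
    refine ⟨n₀ + Nat.card M, fun n hn u v hu h => ?_⟩
    obtain ⟨j, rfl⟩ := Nat.exists_eq_add_of_le (show n₀ ≤ n by omega)
    have hv : v.toFinset.card ≤ k + 1 := by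
      rcases Nat.eq_zero_or_pos (n₀ + j) with h0 | h0
      · have : 0 < Nat.card M := Nat.card_pos
        omega
      · obtain ⟨i, hi⟩ := Nat.exists_eq_add_of_lt h0
        rw [zero_add] at hi
        rw [hi] at h
        rwa [show v.toFinset = u.toFinset by ext a; simp [h.mem_iff_of_ofWord a]]
    obtain ⟨t, ht⟩ := right j (by omega) v u hv h.symm
    obtain ⟨r, hr⟩ := left j (by omega) u v hu h
    exact eq_of_mul_eq_of_mul_eq hDA hN hr ht

end DA

theorem freeMonoid_map_ofList {A M : Type} [Monoid M] (σ : FreeMonoid A →* M) (l : List A) :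
    σ (FreeMonoid.ofList l) = (l.map fun a => σ (FreeMonoid.of a)).prod := by
  induction l with
  | nil => exact map_one σ
  | cons a l ih => rw [FreeMonoid.ofList_cons, map_mul, ih, List.map_cons, List.prod_cons]

theorem eqHoldsIn_of_factorEquiv {A : Type} [Fintype A] {α β : PiTerm A}
    (h : ∀ n, PiTerm.FactorEquiv n α β) (M : Type) [Monoid M] [Finite M] (hM : InDA M) :
    EqHoldsIn α β M := by
  intro σ
  obtain ⟨hN, hidem⟩ := monoidExp_mem M
  obtain ⟨n, hn⟩ := exists_factorEquiv_prod_eq hM hidem (fun a => σ (FreeMonoid.of a))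
    (Fintype.card A)
  have hK : n ≤ monoidExp M * (n + 1) := by nlinarith
  rw [← map_substNat_mul σ hidem n.succ_ne_zero α, ← map_substNat_mul σ hidem n.succ_ne_zero β,
    freeMonoid_map_ofList, freeMonoid_map_ofList]
  exact hn n le_rfl _ _ (Finset.card_le_univ _)
    (((PiTerm.FactorEquiv.ofWord_substNat hK α).symm.trans (h n)).trans
      (PiTerm.FactorEquiv.ofWord_substNat hK β))

/-- Corollary: the infinite XY-relations characterize validity of equations in DA. -/
theorem relations_and_DA_equations (A : Type) [Fintype A] (α β : PiTerm A) :
    (∀ m n : ℕ, wEquiv ZKind.XY m n α.substOO β.substOO) ↔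
      ∀ (M : Type) [Monoid M] [Finite M], InDA M → EqHoldsIn α β M := by
  rw [forall_wEquiv_XY_iff]
  exact ⟨fun h M _ _ hM => eqHoldsIn_of_factorEquiv h M hM, PiTerm.factorEquiv_of_forall_DA⟩
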